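/- arXiv:2009.12645 — 9 statements merged into one kernel-verified Lean document; each statement's English description precedes it below -/
import Mathlib

section
/- Let d ∈ ℂ, let Q = y₁² − y₂² − d²y₃² in ℂ[y₁,y₂,y₃], and let M be the symmetric 6×6 matrix over ℂ[y₁,y₂,y₃] with rows [0,0,0,0,0,Q], [0, y₁+dy₃, 0, y₂, 0, 0], [0, 0, y₁+dy₃, 0, y₂, 0], [0, y₂, 0, y₁−dy₃, 0, 0], [0, 0, y₂, 0, y₁−dy₃, 0], [Q,0,0,0,0,0]. Let L be the 6×6 matrix with rows [0,0,0,0,0,1], [0, y₁−dy₃, 0, −y₂, 0, 0], [0, 0, y₁−dy₃, 0, −y₂, 0], [0, −y₂, 0, y₁+dy₃, 0, 0], [0, 0, −y₂, 0, y₁+dy₃, 0], [1,0,0,0,0,0]. Then for all indices i,j ∈ {1,…,6}, the (i,j) cofactor β_{ij} of M satisfies β_{ij} = L_{ij} · β_{16}. -/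
open MvPolynomial Matrix

/-- If `M * L` is a nonzero scalar matrix and `L` has an entry equal to `1`, then the adjugate of `M`
is the multiple of `L` by the corresponding entry of the adjugate. -/
theorem Matrix.adjugate_eq_smul_of_mul_eq_smul_one {n R : Type*} [Fintype n] [DecidableEq n]
    [CommRing R] [IsDomain R] {M L : Matrix n n R} {q : R} (hq : q ≠ 0)
    (hML : M * L = q • (1 : Matrix n n R)) {a b : n} (hab : L a b = 1) :
    M.adjugate = M.adjugate a b • L := by
  have key : q • M.adjugate = M.det • L := by
    calc q • M.adjugate = M.adjugate * (M * L) := by rw [hML, Matrix.mul_smul, mul_one]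
      _ = M.det • L := by rw [← mul_assoc, adjugate_mul, smul_mul, one_mul]
  have hdet : q * M.adjugate a b = M.det := by
    simpa [hab] using congrFun (congrFun key a) b
  ext i j
  apply mul_left_cancel₀ hq
  simpa [← hdet, mul_assoc] using congrFun (congrFun key i) j

/-- In `ℂ[y₁,y₂,y₃]` (variables `X 0 = y₁`, `X 1 = y₂`, `X 2 = y₃`),
for the given matrices `M` and `L`, every `(i,j)` cofactor `β_{ij}` of `M`
(i.e. the `(j,i)` entry of the adjugate of `M`) satisfies `β_{ij} = L_{ij} · β_{16}`. -/
theorem stmt0 (d : ℂ)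
    (Q : MvPolynomial (Fin 3) ℂ)
    (hQ : Q = X 0 ^ 2 - X 1 ^ 2 - C (d ^ 2) * X 2 ^ 2)
    (M L : Matrix (Fin 6) (Fin 6) (MvPolynomial (Fin 3) ℂ))
    (hM : M = !![0, 0, 0, 0, 0, Q;
                 0, X 0 + C d * X 2, 0, X 1, 0, 0;
                 0, 0, X 0 + C d * X 2, 0, X 1, 0;
                 0, X 1, 0, X 0 - C d * X 2, 0, 0;
                 0, 0, X 1, 0, X 0 - C d * X 2, 0;
                 Q, 0, 0, 0, 0, 0])
    (hL : L = !![0, 0, 0, 0, 0, 1;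
                 0, X 0 - C d * X 2, 0, -X 1, 0, 0;
                 0, 0, X 0 - C d * X 2, 0, -X 1, 0;
                 0, -X 1, 0, X 0 + C d * X 2, 0, 0;
                 0, 0, -X 1, 0, X 0 + C d * X 2, 0;
                 1, 0, 0, 0, 0, 0]) :
    ∀ i j : Fin 6, M.adjugate j i = L i j * M.adjugate 5 0 := by
  have hQ0 : Q ≠ 0 := by
    intro h
    simpa [hQ] using congrArg (eval ![1, 0, 0]) h
  have hML : M * L = Q • (1 : Matrix (Fin 6) (Fin 6) (MvPolynomial (Fin 3) ℂ)) := by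
    subst hM hL
    ext1 i j
    fin_cases i <;> fin_cases j <;>
      simp [Matrix.mul_apply, Fin.sum_univ_succ, hQ] <;> ring
  have hsymm : ∀ i j, L j i = L i j := by
    intro i j
    subst hL
    fin_cases i <;> fin_cases j <;> rfl
  have hL1 : L 5 0 = 1 := by subst hL; rfl
  intro i j
  rw [← hsymm i j, mul_comm]
  exact congrFun (congrFun (adjugate_eq_smul_of_mul_eq_smul_one hQ0 hML hL1) j) i
end

section
/- Let d, a₁, b₁, a₄, b₄, a₅, b₅, a₆, b₆ ∈ ℂ, set Q = y₁² − y₂² − d²y₃² and mᵢ = aᵢy₁ + bᵢy₃ in ℂ[y₁,y₂,y₃] for i ∈ {1,4,5,6}, and let N be the symmetric 4×4 matrix with rows [m₁, y₁, y₂, 0], [y₁, y₃, 0, y₂], [y₂, 0, m₄, m₅], [0, y₂, m₅, m₆]. If Q divides every cofactor of N (i.e., every entry of the adjugate of N), then a₁ = 0, b₁ = d², a₄ = 0, b₄ = −1, a₅ = 1, b₅ = 0, a₆ = 0 and b₆ = −d². -/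
open MvPolynomial Matrix

/-- If `Q = X 0 ^ 2 - X 1 ^ 2 - C (d ^ 2) * X 2 ^ 2` divides every `P i`, then for all `x z` these
vanish at a common point `(x, y, z)` with
`y ^ 2 = x ^ 2 - d ^ 2 * z ^ 2`. -/
theorem exists_eval_eq_zero_of_quadric_dvd {ι : Type*} (d : ℂ) (P : ι → MvPolynomial (Fin 3) ℂ)
    (h : ∀ i, X 0 ^ 2 - X 1 ^ 2 - C (d ^ 2) * X 2 ^ 2 ∣ P i) (x z : ℂ) :
    ∃ y : ℂ, y ^ 2 = x ^ 2 - d ^ 2 * z ^ 2 ∧ ∀ i, eval ![x, y, z] (P i) = 0 := by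
  obtain ⟨y, hy⟩ := IsAlgClosed.exists_pow_nat_eq (x ^ 2 - d ^ 2 * z ^ 2) two_pos
  refine ⟨y, hy, fun i => ?_⟩
  obtain ⟨R, hR⟩ := h i
  simp [hR, hy]

/-- Case 1 of Proposition 3: if `Q = y₁² − y₂² − d²y₃²` divides every
cofactor of the given 4×4 matrix `N` (i.e. every entry of its adjugate), then the
coefficients are forced as stated. Variables: `X 0 = y₁`, `X 1 = y₂`, `X 2 = y₃`. -/
theorem stmt3 (d a₁ b₁ a₄ b₄ a₅ b₅ a₆ b₆ : ℂ)
    (Q : MvPolynomial (Fin 3) ℂ)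
    (hQ : Q = X 0 ^ 2 - X 1 ^ 2 - C (d ^ 2) * X 2 ^ 2)
    (m₁ m₄ m₅ m₆ : MvPolynomial (Fin 3) ℂ)
    (hm₁ : m₁ = C a₁ * X 0 + C b₁ * X 2)
    (hm₄ : m₄ = C a₄ * X 0 + C b₄ * X 2)
    (hm₅ : m₅ = C a₅ * X 0 + C b₅ * X 2)
    (hm₆ : m₆ = C a₆ * X 0 + C b₆ * X 2)
    (N : Matrix (Fin 4) (Fin 4) (MvPolynomial (Fin 3) ℂ))
    (hN : N = !![m₁, X 0, X 1, 0;
                 X 0, X 2, 0, X 1;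
                 X 1, 0, m₄, m₅;
                 0, X 1, m₅, m₆])
    (hdvd : ∀ i j : Fin 4, Q ∣ N.adjugate i j) :
    a₁ = 0 ∧ b₁ = d ^ 2 ∧ a₄ = 0 ∧ b₄ = -1 ∧ a₅ = 1 ∧ b₅ = 0 ∧ a₆ = 0 ∧ b₆ = -(d ^ 2) := by
  subst hQ hm₁ hm₄ hm₅ hm₆ hN
  have minors (x z : ℂ) :
      (a₄ * x + b₄ * z) * ((a₁ * x + b₁ * z) * z - x ^ 2) = (x ^ 2 - d ^ 2 * z ^ 2) * z ∧
      (a₅ * x + b₅ * z) * ((a₁ * x + b₁ * z) * z - x ^ 2) = -(x ^ 2 - d ^ 2 * z ^ 2) * x ∧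
      (a₆ * x + b₆ * z) * ((a₁ * x + b₁ * z) * z - x ^ 2) =
        (x ^ 2 - d ^ 2 * z ^ 2) * (a₁ * x + b₁ * z) := by
    obtain ⟨y, hy, h⟩ := exists_eval_eq_zero_of_quadric_dvd d _
      (fun p : Fin 4 × Fin 4 => hdvd p.1 p.2) x z
    have h₃₃ := h (3, 3)
    have h₃₂ := h (3, 2)
    have h₂₂ := h (2, 2)
    simp [adjugate_fin_succ_eq_det_submatrix, det_fin_three, Fin.succAbove, Fin.lt_def]
      at h₃₃ h₃₂ h₂₂
    rw [← hy]
    refine ⟨?_, ?_, ?_⟩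
    · linear_combination h₃₃
    · linear_combination h₃₂
    · linear_combination h₂₂
  have ha₄ : a₄ = 0 := by linear_combination -(minors 1 0).1
  subst ha₄
  have hb₄ : b₄ = -1 := by
    linear_combination (minors 0 1).1 - ((minors 1 1).1 + (minors (-1) 1).1) / 2
  subst hb₄
  have ha₁ : a₁ = 0 := by linear_combination ((minors (-1) 1).1 - (minors 1 1).1) / 2
  have hb₁ : b₁ = d ^ 2 := by linear_combination -(minors 0 1).1
  subst ha₁ hb₁
  have ha₅ : a₅ = 1 := by linear_combination -(minors 1 0).2.1
  have ha₆ : a₆ = 0 := by linear_combination -(minors 1 0).2.2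
  subst ha₅ ha₆
  have hb₅ : b₅ = 0 := by linear_combination (minors 0 1).2.1 - (minors 1 1).2.1
  have hb₆ : b₆ = -(d ^ 2) := by linear_combination (minors 0 1).2.2 - (minors 1 1).2.2
  exact ⟨rfl, rfl, rfl, rfl, rfl, hb₅, rfl, hb₆⟩
end

section
/- Let d, a₁, b₁, a₄, b₄, a₅, b₅, a₆, b₆ ∈ ℂ, set Q = y₁² − y₂² − d²y₃² and mᵢ = aᵢy₁ + bᵢy₃ in ℂ[y₁,y₂,y₃] for i ∈ {1,4,5,6}, and let N be the symmetric 4×4 matrix with rows [m₁, y₃, y₂, 0], [y₃, y₁, 0, y₂], [y₂, 0, m₄, m₅], [0, y₂, m₅, m₆]. If Q divides every cofactor of N, then d ≠ 0 and a₁ = d⁻², b₁ = 0, a₄ = d², b₄ = 0, a₅ = 0, b₅ = −d², a₆ = 1, b₆ = 0. -/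
open MvPolynomial Matrix

/-- A binary quadratic form (dehomogenised) is zero if its product with `x² - e` vanishes
identically. -/
lemma quadratic_coeffs_eq_zero {e α β γ : ℂ}
    (h : ∀ x : ℂ, (x ^ 2 - e) * (α * x ^ 2 + β * x + γ) = 0) :
    α = 0 ∧ β = 0 ∧ γ = 0 := by
  have hα : α = 0 := by
    linear_combination (h 2 - 4 * h 1 + 6 * h 0 - 4 * h (-1) + h (-2)) / 24
  have hβ : β = 0 := by
    linear_combination (h 2 - 2 * h 1 + 2 * h (-1) - h (-2)) / 12
  refine ⟨hα, hβ, ?_⟩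
  linear_combination (h 1 - 2 * h 0 + h (-1)) / 2 - (1 - e) * hα

/-- If `y₁² - y₂² - e y₃²` divides a polynomial whose values are `y₂` times a form in `y₁, y₃`
modulo that quadric, then the form vanishes. -/
lemma coeffs_eq_zero_of_quadric_dvd {e α β γ : ℂ} {P : MvPolynomial (Fin 3) ℂ}
    (hP : X 0 ^ 2 - X 1 ^ 2 - C e * X 2 ^ 2 ∣ P)
    (hval : ∀ x y : ℂ, y ^ 2 = x ^ 2 - e →
      eval ![x, y, 1] P = y * (α * x ^ 2 + β * x + γ)) :
    α = 0 ∧ β = 0 ∧ γ = 0 := by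
  refine quadratic_coeffs_eq_zero (e := e) fun x => ?_
  obtain ⟨y, hy⟩ := IsAlgClosed.exists_pow_nat_eq (x ^ 2 - e) two_pos
  have hzero : eval ![x, y, 1] P = 0 := by
    obtain ⟨R, rfl⟩ := hP
    simp [hy]
  rw [hval x y hy] at hzero
  rw [← hy]
  linear_combination y * hzero

/-- Case 2 of Proposition 3: if `Q = y₁² − y₂² − d²y₃²` divides every
cofactor of the given 4×4 matrix `N`, then `d ≠ 0` and the coefficients are forced
as stated. Variables: `X 0 = y₁`, `X 1 = y₂`, `X 2 = y₃`. -/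
theorem stmt4 (d a₁ b₁ a₄ b₄ a₅ b₅ a₆ b₆ : ℂ)
    (Q : MvPolynomial (Fin 3) ℂ)
    (hQ : Q = X 0 ^ 2 - X 1 ^ 2 - C (d ^ 2) * X 2 ^ 2)
    (m₁ m₄ m₅ m₆ : MvPolynomial (Fin 3) ℂ)
    (hm₁ : m₁ = C a₁ * X 0 + C b₁ * X 2)
    (hm₄ : m₄ = C a₄ * X 0 + C b₄ * X 2)
    (hm₅ : m₅ = C a₅ * X 0 + C b₅ * X 2)
    (hm₆ : m₆ = C a₆ * X 0 + C b₆ * X 2)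
    (N : Matrix (Fin 4) (Fin 4) (MvPolynomial (Fin 3) ℂ))
    (hN : N = !![m₁, X 2, X 1, 0;
                 X 2, X 0, 0, X 1;
                 X 1, 0, m₄, m₅;
                 0, X 1, m₅, m₆])
    (hdvd : ∀ i j : Fin 4, Q ∣ N.adjugate i j) :
    d ≠ 0 ∧ a₁ = (d ^ 2)⁻¹ ∧ b₁ = 0 ∧ a₄ = d ^ 2 ∧ b₄ = 0 ∧ a₅ = 0 ∧ b₅ = -(d ^ 2) ∧
      a₆ = 1 ∧ b₆ = 0 := by
  have hdet (i j : Fin 4) (x y : ℂ) : eval ![x, y, 1] (N.adjugate i j) =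
      (!![a₁ * x + b₁, 1, y, 0;
          1, x, 0, y;
          y, 0, a₄ * x + b₄, a₅ * x + b₅;
          0, y, a₅ * x + b₅, a₆ * x + b₆] : Matrix (Fin 4) (Fin 4) ℂ).adjugate i j := by
    change (eval ![x, y, 1]).mapMatrix N.adjugate i j = _
    rw [RingHom.map_adjugate]
    refine congrArg (fun M : Matrix (Fin 4) (Fin 4) ℂ => M.adjugate i j) ?_
    subst hN hm₁ hm₄ hm₅ hm₆
    ext i j
    fin_cases i <;> fin_cases j <;> simp
  subst hQ
  obtain ⟨h1, h2, h3⟩ := coeffs_eq_zero_of_quadric_dvd (α := 1 - a₆) (β := -(a₅ + b₆))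
    (γ := -d ^ 2 - b₅) (hdvd 0 2) fun x y hy => by
      rw [hdet, adjugate_fin_succ_eq_det_submatrix]
      simp [det_fin_three, Fin.succAbove, submatrix]
      linear_combination y * hy
  obtain ⟨h4, h5, -⟩ := coeffs_eq_zero_of_quadric_dvd (α := 1 - a₁ * a₄)
    (β := -(a₁ * b₄ + b₁ * a₄ + a₅)) (γ := -d ^ 2 - b₅ - b₁ * b₄) (hdvd 1 3) fun x y hy => by
      rw [hdet, adjugate_fin_succ_eq_det_submatrix]
      simp [det_fin_three, Fin.succAbove, submatrix]
      linear_combination y * hy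
  obtain ⟨h6, h7, h8⟩ := coeffs_eq_zero_of_quadric_dvd (α := a₁ * a₅)
    (β := a₁ * b₅ + b₁ * a₅ + a₆) (γ := b₁ * b₅ + b₆) (hdvd 1 2) fun x y hy => by
      rw [hdet, adjugate_fin_succ_eq_det_submatrix]
      simp [det_fin_three, Fin.succAbove, submatrix]
      ring
  have ha₅ : a₅ = 0 := by linear_combination a₄ * h6 + a₅ * h4
  have hb₆ : b₆ = 0 := by linear_combination -h2 - ha₅
  have ha₆ : a₆ = 1 := by linear_combination -h1
  have hb₅ : b₅ = -(d ^ 2) := by linear_combination -h3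
  subst ha₅ hb₆ ha₆ hb₅
  have hmul : a₁ * d ^ 2 = 1 := by linear_combination -h7
  have hd : d ≠ 0 := by
    rintro rfl
    simp at hmul
  have hb₁ : b₁ = 0 := by simpa [hd] using h8
  have ha₄ : a₄ = d ^ 2 := by linear_combination -d ^ 2 * h4 - a₄ * hmul
  have hb₄ : b₄ = 0 := by
    linear_combination -d ^ 2 * h5 - b₄ * hmul - d ^ 2 * a₄ * hb₁
  exact ⟨hd, eq_inv_of_mul_eq_one_left hmul, hb₁, ha₄, hb₄, rfl, rfl, rfl, rfl⟩
end

section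
/- Let d, a₁, b₁, a₃, b₃, a₄, b₄, a₅, b₅, a₆, b₆ ∈ ℂ, set Q = y₁² − y₂² − d²y₃² and mᵢ = aᵢy₁ + bᵢy₃ in ℂ[y₁,y₂,y₃] for i ∈ {1,3,4,5,6}, and let N be the symmetric 4×4 matrix with rows [m₁, 0, y₂, 0], [0, m₃, 0, y₂], [y₂, 0, m₄, m₅], [0, y₂, m₅, m₆]. If Q divides every cofactor of N, then a₅ = b₅ = 0, a₃a₆ = 1, a₁a₄ = 1, b₃a₆ + a₃b₆ = 0, b₁a₄ + a₁b₄ = 0, b₃b₆ = −d² and b₁b₄ = −d². -/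
open MvPolynomial Matrix

/-- The adjugate of the symmetric matrix with two interlaced `2 × 2` blocks coupled by `m₅`:
the entries used to read off the coefficients. -/
theorem adjugate_interlaced_entries {R : Type*} [CommRing R] (m₁ m₃ m₄ m₅ m₆ y : R) :
    let N : Matrix (Fin 4) (Fin 4) R := !![m₁, 0, y, 0; 0, m₃, 0, y; y, 0, m₄, m₅; 0, y, m₅, m₆]
    N.adjugate 0 1 = -(y ^ 2 * m₅) ∧
      N.adjugate 0 2 = -(y * (m₃ * m₆ - y ^ 2)) ∧
      N.adjugate 1 3 = -(y * (m₁ * m₄ - y ^ 2)) := by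
  refine ⟨?_, ?_, ?_⟩ <;>
    simp [adjugate_fin_succ_eq_det_submatrix, det_fin_three, Fin.succAbove] <;> ring

/-- A product of two linear forms agreeing with `x² - d² z²` wherever the latter is a nonzero
square `y²` has the same coefficients as `x² - d² z²`. -/
theorem coeff_eq_of_mul_eq_sq {d a b p q : ℂ}
    (h : ∀ x y z : ℂ, y ≠ 0 → x ^ 2 - y ^ 2 - d ^ 2 * z ^ 2 = 0 →
      (a * x + b * z) * (p * x + q * z) = y ^ 2) :
    a * p = 1 ∧ b * p + a * q = 0 ∧ b * q = -(d ^ 2) := by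
  obtain ⟨s, hs⟩ := IsAlgClosed.exists_pow_nat_eq (1 + d ^ 2) two_pos
  obtain ⟨r, hr⟩ := IsAlgClosed.exists_pow_nat_eq (4 + d ^ 2) two_pos
  have hlead : a * p = 1 := by
    linear_combination h 1 1 0 one_ne_zero (by ring)
  have hS := h s 1 1 one_ne_zero (by linear_combination hs)
  have hR := h r 2 1 two_ne_zero (by linear_combination hr)
  have hsr : s - r ≠ 0 := by
    intro hsr
    have : (3 : ℂ) = 0 := by linear_combination hs - hr - (s + r) * hsr
    norm_num at this
  have hmid : b * p + a * q = 0 := by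
    refine (mul_eq_zero.mp ?_).resolve_left hsr
    linear_combination hS - hR - (s ^ 2 - r ^ 2) * hlead - hs + hr
  refine ⟨hlead, hmid, ?_⟩
  linear_combination hS - s ^ 2 * hlead - s * hmid - hs

/-- Case 3 of Proposition 3: if `Q = y₁² − y₂² − d²y₃²` divides every
cofactor of the given 4×4 matrix `N`, then the stated relations among the
coefficients hold. Variables: `X 0 = y₁`, `X 1 = y₂`, `X 2 = y₃`. -/
theorem stmt5 (d a₁ b₁ a₃ b₃ a₄ b₄ a₅ b₅ a₆ b₆ : ℂ)
    (Q : MvPolynomial (Fin 3) ℂ)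
    (hQ : Q = X 0 ^ 2 - X 1 ^ 2 - C (d ^ 2) * X 2 ^ 2)
    (m₁ m₃ m₄ m₅ m₆ : MvPolynomial (Fin 3) ℂ)
    (hm₁ : m₁ = C a₁ * X 0 + C b₁ * X 2)
    (hm₃ : m₃ = C a₃ * X 0 + C b₃ * X 2)
    (hm₄ : m₄ = C a₄ * X 0 + C b₄ * X 2)
    (hm₅ : m₅ = C a₅ * X 0 + C b₅ * X 2)
    (hm₆ : m₆ = C a₆ * X 0 + C b₆ * X 2)
    (N : Matrix (Fin 4) (Fin 4) (MvPolynomial (Fin 3) ℂ))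
    (hN : N = !![m₁, 0, X 1, 0;
                 0, m₃, 0, X 1;
                 X 1, 0, m₄, m₅;
                 0, X 1, m₅, m₆])
    (hdvd : ∀ i j : Fin 4, Q ∣ N.adjugate i j) :
    a₅ = 0 ∧ b₅ = 0 ∧ a₃ * a₆ = 1 ∧ a₁ * a₄ = 1 ∧ b₃ * a₆ + a₃ * b₆ = 0 ∧
      b₁ * a₄ + a₁ * b₄ = 0 ∧ b₃ * b₆ = -(d ^ 2) ∧ b₁ * b₄ = -(d ^ 2) := by
  have hev : ∀ x y z : ℂ, x ^ 2 - y ^ 2 - d ^ 2 * z ^ 2 = 0 → ∀ i j,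
      eval ![x, y, z] (N.adjugate i j) = 0 := by
    intro x y z hxyz i j
    refine zero_dvd_iff.mp ?_
    have hQ0 : eval ![x, y, z] Q = 0 := by simpa [hQ] using hxyz
    exact hQ0 ▸ map_dvd (eval ![x, y, z]) (hdvd i j)
  obtain ⟨h01, h02, h13⟩ := adjugate_interlaced_entries m₁ m₃ m₄ m₅ m₆ (X 1)
  rw [← hN] at h01 h02 h13
  have h₅ : ∀ x y z : ℂ, y ≠ 0 → x ^ 2 - y ^ 2 - d ^ 2 * z ^ 2 = 0 → a₅ * x + b₅ * z = 0 := by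
    intro x y z hy hxyz
    have h := hev x y z hxyz 0 1
    rw [h01] at h
    simpa [hm₅, hy] using h
  have h₃₆ := coeff_eq_of_mul_eq_sq (d := d) (a := a₃) (b := b₃) (p := a₆) (q := b₆) (by
    intro x y z hy hxyz
    have h := hev x y z hxyz 0 2
    rw [h02] at h
    simpa [hm₃, hm₆, hy, sub_eq_zero] using h)
  have h₁₄ := coeff_eq_of_mul_eq_sq (d := d) (a := a₁) (b := b₁) (p := a₄) (q := b₄) (by
    intro x y z hy hxyz
    have h := hev x y z hxyz 1 3
    rw [h13] at h
    simpa [hm₁, hm₄, hy, sub_eq_zero] using h)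
  have ha₅ : a₅ = 0 := by simpa using h₅ 1 1 0 one_ne_zero (by ring)
  have hb₅ : b₅ = 0 := by
    obtain ⟨s, hs⟩ := IsAlgClosed.exists_pow_nat_eq (1 + d ^ 2) two_pos
    simpa [ha₅] using h₅ s 1 1 one_ne_zero (by linear_combination hs)
  exact ⟨ha₅, hb₅, h₃₆.1, h₁₄.1, h₃₆.2.1, h₁₄.2.1, h₃₆.2.2, h₁₄.2.2⟩
end

section
/- Let d ∈ ℂ with d ≠ 0 and let r ∈ ℂ satisfy r⁴ + d² = 0. Set Q = y₁² − y₂² − d²y₃² in ℂ[y₁,y₂,y₃]. Let M₀ be the symmetric 6×6 matrix with rows [0,0,0,0,0,Q], [0, d²y₃, y₁, y₂, 0, 0], [0, y₁, y₃, 0, y₂, 0], [0, y₂, 0, −y₃, y₁, 0], [0, 0, y₂, y₁, −d²y₃, 0], [Q,0,0,0,0,0], and let M be the symmetric 6×6 matrix with rows [0,0,0,0,0,Q], [0, d⁻²y₁, y₃, y₂, 0, 0], [0, y₃, y₁, 0, y₂, 0], [0, y₂, 0, d²y₁, −d²y₃, 0], [0, 0, y₂, −d²y₃, y₁, 0], [Q,0,0,0,0,0].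 Let P be the diagonal matrix Diag(1, r³, r³d⁻², −rd⁻², −r, 1), and let φ be the ℂ-algebra endomorphism of ℂ[y₁,y₂,y₃] determined by y₁ ↦ −r²y₃, y₂ ↦ y₂, y₃ ↦ −r²d⁻²y₁. Then applying φ to every entry of M₀ yields the matrix P·M·Pᵀ. -/
open MvPolynomial Matrix

/-- with `r⁴ + d² = 0`, `d ≠ 0`, the change of variables
`y₁ ↦ −r²y₃, y₂ ↦ y₂, y₃ ↦ −r²d⁻²y₁` applied to the entries of `M₀`
yields `P·M·Pᵀ`. Variables: `X 0 = y₁`, `X 1 = y₂`, `X 2 = y₃`. -/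
theorem stmt6 (d r : ℂ) (hd : d ≠ 0) (hr : r ^ 4 + d ^ 2 = 0)
    (Q : MvPolynomial (Fin 3) ℂ)
    (hQ : Q = X 0 ^ 2 - X 1 ^ 2 - C (d ^ 2) * X 2 ^ 2)
    (M₀ M : Matrix (Fin 6) (Fin 6) (MvPolynomial (Fin 3) ℂ))
    (hM₀ : M₀ = !![0, 0, 0, 0, 0, Q;
                   0, C (d ^ 2) * X 2, X 0, X 1, 0, 0;
                   0, X 0, X 2, 0, X 1, 0;
                   0, X 1, 0, -X 2, X 0, 0;
                   0, 0, X 1, X 0, -(C (d ^ 2) * X 2), 0;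
                   Q, 0, 0, 0, 0, 0])
    (hM : M = !![0, 0, 0, 0, 0, Q;
                 0, C ((d ^ 2)⁻¹) * X 0, X 2, X 1, 0, 0;
                 0, X 2, X 0, 0, X 1, 0;
                 0, X 1, 0, C (d ^ 2) * X 0, -(C (d ^ 2) * X 2), 0;
                 0, 0, X 1, -(C (d ^ 2) * X 2), X 0, 0;
                 Q, 0, 0, 0, 0, 0])
    (P : Matrix (Fin 6) (Fin 6) (MvPolynomial (Fin 3) ℂ))
    (hP : P = Matrix.diagonal ![1, C (r ^ 3), C (r ^ 3 * (d ^ 2)⁻¹),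
                                -(C (r * (d ^ 2)⁻¹)), -(C r), 1])
    (φ : MvPolynomial (Fin 3) ℂ →ₐ[ℂ] MvPolynomial (Fin 3) ℂ)
    (hφ : φ = aeval ![-(C (r ^ 2)) * X 2, X 1, -(C (r ^ 2 * (d ^ 2)⁻¹)) * X 0]) :
    M₀.map φ = P * M * Pᵀ := by
  have hE : (C (d ^ 2)⁻¹ : MvPolynomial (Fin 3) ℂ) * C d ^ 2 = 1 := by
    rw [← C_pow, ← C_mul, inv_mul_cancel₀ (pow_ne_zero 2 hd), C_1]
  have hR : (C r : MvPolynomial (Fin 3) ℂ) ^ 4 + C d ^ 2 = 0 := by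
    rw [← C_pow, ← C_pow, ← C_add, hr, C_0]
  have h0 : φ (X 0) = -(C r ^ 2) * X 2 := by simp [hφ]
  have h1 : φ (X 1) = X 1 := by simp [hφ]
  have h2 : φ (X 2) = -(C r ^ 2 * C (d ^ 2)⁻¹) * X 0 := by
    simp only [hφ, aeval_X, cons_val, C_mul, C_pow]
  have hC (a : ℂ) : φ (C a) = C a := φ.commutes a
  subst hP hM₀ hM hQ
  rw [diagonal_transpose]
  ext1 i j
  rw [mul_diagonal, diagonal_mul, map_apply]
  clear hφ
  generalize (d ^ 2)⁻¹ = e at *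
  fin_cases i <;> fin_cases j <;>
    simp [h0, h1, h2, hC] <;> grind
end

section
/- Let d ∈ ℂ and let N₀ be the symmetric 4×4 matrix over ℂ[y₁,y₂,y₃] with rows [d²y₃, y₁, y₂, 0], [y₁, y₃, 0, y₂], [y₂, 0, −y₃, y₁], [0, y₂, y₁, −d²y₃], and let Q = y₁² − y₂² − d²y₃². Then every 3×3 minor of N₀ (the determinant of any 3×3 submatrix obtained by choosing any three rows and any three columns of N₀) is divisible by Q in ℂ[y₁,y₂,y₃]. -/
open MvPolynomial Matrix

/-- An injection `Fin n → Fin (n + 1)` is a permutation followed by some `Fin.succAbove i`. -/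
theorem exists_eq_succAbove_comp_perm {n : ℕ} (r : Fin n → Fin (n + 1))
    (hr : Function.Injective r) :
    ∃ (i : Fin (n + 1)) (σ : Equiv.Perm (Fin n)), r = i.succAbove ∘ σ := by
  have hns : ¬ Function.Surjective r := fun hs => by
    simpa using Fintype.card_le_of_surjective r hs
  obtain ⟨i, hi⟩ := not_forall.mp hns
  have hne : ∀ k, ∃ m, i.succAbove m = r k := fun k =>
    Fin.exists_succAbove_eq fun h => hi ⟨k, h⟩
  choose σ hσ using hne
  have hinj : Function.Injective σ := fun a b hab => hr (by rw [← hσ a, ← hσ b, hab])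
  exact ⟨i, Equiv.ofBijective σ (Finite.injective_iff_bijective.mp hinj),
    funext fun k => (hσ k).symm⟩

/-- To divide all maximal proper minors on injectively chosen rows and columns, it suffices to
divide those obtained by deleting one row and one column. -/
theorem dvd_det_submatrix_of_dvd_succAbove {R : Type*} [CommRing R] {n : ℕ}
    (A : Matrix (Fin (n + 1)) (Fin (n + 1)) R) (q : R)
    (h : ∀ i j : Fin (n + 1), q ∣ (A.submatrix i.succAbove j.succAbove).det)
    (r c : Fin n → Fin (n + 1)) (hr : Function.Injective r) (hc : Function.Injective c) :
    q ∣ (A.submatrix r c).det := by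
  obtain ⟨i, σ, rfl⟩ := exists_eq_succAbove_comp_perm r hr
  obtain ⟨j, τ, rfl⟩ := exists_eq_succAbove_comp_perm c hc
  have hdet : (A.submatrix (i.succAbove ∘ σ) (j.succAbove ∘ τ)).det =
      Equiv.Perm.sign σ * (Equiv.Perm.sign τ *
        (A.submatrix i.succAbove j.succAbove).det) := by
    rw [← Matrix.det_permute', ← Matrix.det_permute]
    rfl
  rw [hdet]
  exact ((h i j).mul_left _).mul_left _

/-- The minors of the matrix obtained by deleting row `i` and column `j`, in factored form. -/
theorem det_submatrix_succAbove_eq {R : Type*} [CommRing R] (w x y z : R) (i j : Fin 4) :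
    ((!![w * z, x, y, 0; x, z, 0, y; y, 0, -z, x; 0, y, x, -(w * z)] :
      Matrix (Fin 4) (Fin 4) R).submatrix i.succAbove j.succAbove).det =
    (x ^ 2 - y ^ 2 - w * z ^ 2) *
      (!![-z, -x, -y, 0; -x, -(w * z), 0, -y; -y, 0, w * z, -x; 0, -y, -x, z] :
        Matrix (Fin 4) (Fin 4) R) i j := by
  fin_cases i <;> fin_cases j <;>
    simp [Matrix.det_fin_three, Fin.succAbove, Fin.lt_def] <;> ring

/-- every 3×3 minor of `N₀` (determinant of the submatrix on any three
rows and any three columns) is divisible by `Q = y₁² − y₂² − d²y₃²`.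
Variables: `X 0 = y₁`, `X 1 = y₂`, `X 2 = y₃`. -/
theorem stmt8 (d : ℂ)
    (Q : MvPolynomial (Fin 3) ℂ)
    (hQ : Q = X 0 ^ 2 - X 1 ^ 2 - C (d ^ 2) * X 2 ^ 2)
    (N₀ : Matrix (Fin 4) (Fin 4) (MvPolynomial (Fin 3) ℂ))
    (hN₀ : N₀ = !![C (d ^ 2) * X 2, X 0, X 1, 0;
                   X 0, X 2, 0, X 1;
                   X 1, 0, -X 2, X 0;
                   0, X 1, X 0, -(C (d ^ 2) * X 2)]) :
    ∀ r c : Fin 3 → Fin 4, Function.Injective r → Function.Injective c →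
      Q ∣ (N₀.submatrix r c).det := by
  subst hQ hN₀
  exact dvd_det_submatrix_of_dvd_succAbove _ _ fun i j =>
    ⟨_, det_submatrix_succAbove_eq (C (d ^ 2)) (X 0) (X 1) (X 2) i j⟩
end

section
/- Let k, d ∈ ℂ with 1 − d²k² ≠ 0, let r ∈ ℂ satisfy r² = 1/(1 − d²k²), and set a = r²(1 + d²k²) and b = 2kr². Let N₀(u₁,u₂,u₃) denote the symmetric 4×4 matrix with rows [d²u₃, u₁, u₂, 0], [u₁, u₃, 0, u₂], [u₂, 0, −u₃, u₁], [0, u₂, u₁, −d²u₃]. Let P₀ be the block-diagonal 4×4 matrix with upper-left 2×2 block r·[[1, −d²k],[−k, 1]] and lower-right 2×2 block r·[[1, k],[d²k, 1]]. Then, over ℂ[y₁,y₂,y₃], P₀ · N₀(y₁,y₂,y₃) · P₀ᵀ = N₀(a·y₁ − d²b·y₃, y₂, −b·y₁ + a·y₃). -/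
open MvPolynomial Matrix

/-- with `r² = 1/(1 − d²k²)`, `a = r²(1 + d²k²)`, `b = 2kr²`, the matrix
`P₀ · N₀(y₁,y₂,y₃) · P₀ᵀ` equals `N₀(a·y₁ − d²b·y₃, y₂, −b·y₁ + a·y₃)`.
Variables: `X 0 = y₁`, `X 1 = y₂`, `X 2 = y₃`. -/
theorem stmt11 (k d r : ℂ) (h : 1 - d ^ 2 * k ^ 2 ≠ 0)
    (hr : r ^ 2 = 1 / (1 - d ^ 2 * k ^ 2))
    (a b : ℂ) (ha : a = r ^ 2 * (1 + d ^ 2 * k ^ 2)) (hb : b = 2 * k * r ^ 2)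
    (N₀ : MvPolynomial (Fin 3) ℂ → MvPolynomial (Fin 3) ℂ → MvPolynomial (Fin 3) ℂ →
          Matrix (Fin 4) (Fin 4) (MvPolynomial (Fin 3) ℂ))
    (hN₀ : ∀ u₁ u₂ u₃, N₀ u₁ u₂ u₃ = !![C (d ^ 2) * u₃, u₁, u₂, 0;
                                         u₁, u₃, 0, u₂;
                                         u₂, 0, -u₃, u₁;
                                         0, u₂, u₁, -(C (d ^ 2) * u₃)])
    (P₀ : Matrix (Fin 4) (Fin 4) (MvPolynomial (Fin 3) ℂ))
    (hP₀ : P₀ = !![C r, -(C (r * (d ^ 2 * k))), 0, 0;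
                   -(C (r * k)), C r, 0, 0;
                   0, 0, C r, C (r * k);
                   0, 0, C (r * (d ^ 2 * k)), C r]) :
    P₀ * N₀ (X 0) (X 1) (X 2) * P₀ᵀ
      = N₀ (C a * X 0 - C (d ^ 2 * b) * X 2) (X 1) (-(C b) * X 0 + C a * X 2) := by
  have hC : (C r : MvPolynomial (Fin 3) ℂ) ^ 2 * (1 - C d ^ 2 * C k ^ 2) = 1 := by
    have hrc : r ^ 2 * (1 - d ^ 2 * k ^ 2) = 1 := by rw [hr, one_div_mul_cancel h]
    simpa using congrArg (C : ℂ → MvPolynomial (Fin 3) ℂ) hrc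
  have hC2 : (C 2 : MvPolynomial (Fin 3) ℂ) = 2 := map_ofNat C 2
  subst ha hb hP₀
  rw [hN₀, hN₀]
  ext1 i j
  fin_cases i <;> fin_cases j <;>
    simp [Matrix.mul_apply, Fin.sum_univ_four, hC2] <;>
    first
      | ring1
      | linear_combination (X 1 : MvPolynomial (Fin 3) ℂ) * hC
end

section
/- Let s ∈ ℂ with s ≠ 0 and put c = s⁴. In ℂ[x,y₁,y₂,y₃,y₄], let N_c be the symmetric 4×4 matrix with rows [y₄, y₁, y₂, 0], [y₁, y₃, c·x², y₂], [y₂, c·x², −y₃, y₁], [0, y₂, y₁, −y₄], let P₀ = Diag(s, 1/s, 1/s, s), and let φ be the ℂ-algebra endomorphism of ℂ[x,y₁,y₂,y₃,y₄] determined by x ↦ x/s, y₁ ↦ y₁, y₂ ↦ y₂, y₃ ↦ s²y₃, y₄ ↦ y₄/s². Then applying φ to every entry of P₀ · N_c · P₀ᵀ yields the matrix N₁ (the matrix N_c with c = 1). Moreover φ(y₁² − y₂² − y₃y₄) = y₁² − y₂² − y₃y₄. -/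
open MvPolynomial Matrix

/-- with `c = s⁴`, `s ≠ 0`, applying the substitution
`x ↦ x/s, y₁ ↦ y₁, y₂ ↦ y₂, y₃ ↦ s²y₃, y₄ ↦ y₄/s²` to the entries of `P₀ · N_c · P₀ᵀ`
yields `N₁`, and the substitution fixes `y₁² − y₂² − y₃y₄`.
Variables in `ℂ[x,y₁,y₂,y₃,y₄]`: `X 0 = x`, `X 1 = y₁`, `X 2 = y₂`, `X 3 = y₃`, `X 4 = y₄`. -/
theorem stmt12 (s : ℂ) (hs : s ≠ 0) (c : ℂ) (hc : c = s ^ 4)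
    (Nmat : ℂ → Matrix (Fin 4) (Fin 4) (MvPolynomial (Fin 5) ℂ))
    (hNmat : ∀ u : ℂ, Nmat u = !![X 4, X 1, X 2, 0;
                                   X 1, X 3, C u * X 0 ^ 2, X 2;
                                   X 2, C u * X 0 ^ 2, -X 3, X 1;
                                   0, X 2, X 1, -X 4])
    (P₀ : Matrix (Fin 4) (Fin 4) (MvPolynomial (Fin 5) ℂ))
    (hP₀ : P₀ = Matrix.diagonal ![C s, C s⁻¹, C s⁻¹, C s])
    (φ : MvPolynomial (Fin 5) ℂ →ₐ[ℂ] MvPolynomial (Fin 5) ℂ)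
    (hφ : φ = aeval ![C s⁻¹ * X 0, X 1, X 2, C (s ^ 2) * X 3, C ((s ^ 2)⁻¹) * X 4]) :
    (P₀ * Nmat c * P₀ᵀ).map φ = Nmat 1 ∧
      φ (X 1 ^ 2 - X 2 ^ 2 - X 3 * X 4) = X 1 ^ 2 - X 2 ^ 2 - X 3 * X 4 := by
  have hunit : (C s : MvPolynomial (Fin 5) ℂ) * C s⁻¹ = 1 := by
    rw [← C_mul, mul_inv_cancel₀ hs, C_1]
  have hC (u : ℂ) : φ (C u) = C u := φ.commutes u
  have h0 : φ (X 0) = C s⁻¹ * X 0 := by simp [hφ]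
  have h1 : φ (X 1) = X 1 := by simp [hφ]
  have h2 : φ (X 2) = X 2 := by simp [hφ]
  have h3 : φ (X 3) = C s ^ 2 * X 3 := by simp [hφ]
  have h4 : φ (X 4) = C s⁻¹ ^ 2 * X 4 := by simp [hφ, ← inv_pow]
  clear hφ
  subst hc hP₀
  constructor
  · ext1 i j
    rw [diagonal_transpose, map_apply, mul_diagonal, diagonal_mul, hNmat, hNmat]
    fin_cases i <;> fin_cases j <;>
      simp only [Fin.zero_eta, Fin.mk_one, Fin.reduceFinMk, Fin.isValue, of_apply, cons_val,
        map_mul, map_neg, map_pow, map_zero, map_one, hC, h0, h1, h2, h3, h4] <;>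
      grind
  · simp only [map_sub, map_mul, map_pow, h1, h2, h3, h4]
    grind
end

section
/- Work in R = ℂ[x,y₁,y₂,y₄] and let σ be the ℂ-algebra involution of R determined by x ↦ −x, y₁ ↦ −y₁, y₂ ↦ y₂, y₄ ↦ −y₄. Let G ∈ R be any ℂ-linear combination of degree-3 monomials in (x², y₁, y₂, y₄) with σ(G) = −G; let q₁, q₂ ∈ R be ℂ-linear combinations of degree-2 monomials in (x², y₁, y₂, y₄) with σ(qᵢ) = −qᵢ; let q₃, q₄ ∈ R be ℂ-linear combinations of degree-2 monomials in (x², y₁, y₂, y₄) with σ(qᵢ) = qᵢ; and set Q = y₁² − y₂². Let α₃ be the symmetric 6×6 matrix with rows [x²G, xq₁, xq₂, xq₃, xq₄, Q], [xq₁, y₄, y₁, y₂, 0, x], [xq₂, y₁, 0, 0, y₂, 0], [xq₃, y₂, 0, 0, y₁, 0], [xq₄, 0, y₂, y₁, −y₄, 0], [Q, x, 0, 0, 0, 0]. Then det α₃ is a square in R, i.e., there exists p ∈ R with det α₃ = p². -/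
open MvPolynomial Matrix

/-- in `R = ℂ[x,y₁,y₂,y₄]` (variables `X 0 = x`, `X 1 = y₁`, `X 2 = y₂`,
`X 3 = y₄`) with involution `σ : x ↦ −x, y₁ ↦ −y₁, y₂ ↦ y₂, y₄ ↦ −y₄`, for any `G`
(a `σ`-anti-invariant linear combination of degree-3 monomials in `(x², y₁, y₂, y₄)`),
`q₁, q₂` (anti-invariant, degree 2) and `q₃, q₄` (invariant, degree 2), the determinant
of the matrix `α₃` is a square in `R`. -/
theorem stmt15
    (σ : MvPolynomial (Fin 4) ℂ →ₐ[ℂ] MvPolynomial (Fin 4) ℂ)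
    (hσ : σ = aeval ![-X 0, -X 1, X 2, -X 3])
    (G q₁ q₂ q₃ q₄ : MvPolynomial (Fin 4) ℂ)
    (hGspan : G ∈ Submodule.span ℂ {p : MvPolynomial (Fin 4) ℂ |
      ∃ f : Fin 3 → Fin 4, p = ∏ i, (![X 0 ^ 2, X 1, X 2, X 3] : Fin 4 → _) (f i)})
    (hGσ : σ G = -G)
    (hq₁span : q₁ ∈ Submodule.span ℂ {p : MvPolynomial (Fin 4) ℂ |
      ∃ f : Fin 2 → Fin 4, p = ∏ i, (![X 0 ^ 2, X 1, X 2, X 3] : Fin 4 → _) (f i)})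
    (hq₁σ : σ q₁ = -q₁)
    (hq₂span : q₂ ∈ Submodule.span ℂ {p : MvPolynomial (Fin 4) ℂ |
      ∃ f : Fin 2 → Fin 4, p = ∏ i, (![X 0 ^ 2, X 1, X 2, X 3] : Fin 4 → _) (f i)})
    (hq₂σ : σ q₂ = -q₂)
    (hq₃span : q₃ ∈ Submodule.span ℂ {p : MvPolynomial (Fin 4) ℂ |
      ∃ f : Fin 2 → Fin 4, p = ∏ i, (![X 0 ^ 2, X 1, X 2, X 3] : Fin 4 → _) (f i)})
    (hq₃σ : σ q₃ = q₃)
    (hq₄span : q₄ ∈ Submodule.span ℂ {p : MvPolynomial (Fin 4) ℂ |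
      ∃ f : Fin 2 → Fin 4, p = ∏ i, (![X 0 ^ 2, X 1, X 2, X 3] : Fin 4 → _) (f i)})
    (hq₄σ : σ q₄ = q₄)
    (Q : MvPolynomial (Fin 4) ℂ) (hQ : Q = X 1 ^ 2 - X 2 ^ 2)
    (α₃ : Matrix (Fin 6) (Fin 6) (MvPolynomial (Fin 4) ℂ))
    (hα₃ : α₃ = !![X 0 ^ 2 * G, X 0 * q₁, X 0 * q₂, X 0 * q₃, X 0 * q₄, Q;
                   X 0 * q₁, X 3, X 1, X 2, 0, X 0;
                   X 0 * q₂, X 1, 0, 0, X 2, 0;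
                   X 0 * q₃, X 2, 0, 0, X 1, 0;
                   X 0 * q₄, 0, X 2, X 1, -X 3, 0;
                   Q, X 0, 0, 0, 0, 0]) :
    ∃ p : MvPolynomial (Fin 4) ℂ, α₃.det = p ^ 2 := by
  have hI : (C Complex.I : MvPolynomial (Fin 4) ℂ) ^ 2 = -1 := by
    rw [← C_pow, Complex.I_sq, C_neg, C_1]
  refine ⟨C Complex.I * (Q ^ 2 - X 0 ^ 2 * (X 1 * q₂ - X 2 * q₃)), ?_⟩
  rw [mul_pow, hI, hα₃, hQ]
  simp [det_succ_row_zero, Fin.sum_univ_succ, Fin.succAbove]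
  ring
end
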